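/- Let 𝔤 be a finite-dimensional semisimple Lie algebra over an algebraically closed field of characteristic 0, 𝔥 a Cartan subalgebra, Δ ⊆ 𝔥* the set of roots, 𝔱 ⊆ 𝔥 a subspace, and (e, h, f) an sl₂-triple in 𝔤 whose members centralize 𝔱, with h ∈ 𝔥. Fix θ ∈ 𝔱 such that α(θ) ∈ ℤ for every root α and α(θ) ≠ 0 for every root α with α|_𝔱 ≠ 0. Define δ := (1/2) ∑_{α∈Δ: α(θ)<0, α(h)=−1} α + ∑_{α∈Δ: α(θ)<0, α(h)≤−2} α, δ' := (1/2) ∑_{α∈Δ: α(θ)>0, α(h)∈{0,1}} α, and ρ_θ := (1/2) ∑_{α∈Δ: α(θ)>0} α. Then the restriction of δ' − δ − ρ_θ to 𝔱 is zero; equivalently, δ' ≡ δ + ρ modulo the ℚ-linear span of the roots vanishing on 𝔱, where ρ is half the sum of the positive roots for any simple system on which θ is dominant. -/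

import Mathlib

open LieModule

namespace LieAlgebra

/-- A member of a finite-dimensional associative algebra over a field of characteristic zero which
is an eigenvector of an inner derivation with nonzero eigenvalue is nilpotent. -/
lemma isNilpotent_of_commutator_eq_smul {𝕜 A : Type*} [Field 𝕜] [CharZero 𝕜] [Ring A] [Algebra 𝕜 A]
    [FiniteDimensional 𝕜 A] {a b : A} {c : 𝕜} (hc : c ≠ 0)
    (hab : a * b - b * a = c • b) : IsNilpotent b := by
  by_contra hb
  have hpow (n : ℕ) : a * b ^ n - b ^ n * a = ((n : 𝕜) * c) • b ^ n := by
    induction n with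
    | zero => simp
    | succ n ih =>
      have : a * b ^ (n + 1) - b ^ (n + 1) * a =
          (a * b ^ n - b ^ n * a) * b + b ^ n * (a * b - b * a) := by
        noncomm_ring
      rw [this, ih, hab, smul_mul_assoc, mul_smul_comm, ← pow_succ, ← add_smul]
      push_cast
      ring_nf
  refine Set.infinite_range_of_injective (f := fun n : ℕ ↦ (n : 𝕜) * c) (fun m n hmn ↦ ?_) ?_
  · simpa [hc] using hmn
  · refine (Module.End.finite_hasEigenvalue (LinearMap.mulLeft 𝕜 a - LinearMap.mulRight 𝕜 a)).subset ?_
    rintro _ ⟨n, rfl⟩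
    refine Module.End.hasEigenvalue_of_hasEigenvector (x := b ^ n) ⟨?_, fun h0 ↦ hb ⟨n, h0⟩⟩
    simpa [Module.End.mem_eigenspace_iff] using hpow n

/-- The exponential of `ad y` is a Lie algebra automorphism, which on vectors killed by `(ad y)³`
is given by the quadratic truncation. -/
lemma exists_lieEquiv_exp_ad {𝕜 L : Type*} [Field 𝕜] [CharZero 𝕜] [LieRing L] [LieAlgebra 𝕜 L]
    {y : L} (hy : IsNilpotent (ad 𝕜 L y)) :
    ∃ σ : L ≃ₗ⁅𝕜⁆ L, ∀ v, ⁅y, ⁅y, ⁅y, v⁆⁆⁆ = 0 →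
      σ v = v + ⁅y, v⁆ + (2⁻¹ : 𝕜) • ⁅y, ⁅y, v⁆⁆ := by
  let _ : LieAlgebra ℚ L :=
    { Module.compHom L (algebraMap ℚ 𝕜) with
      lie_smul := fun q x z ↦ lie_smul (algebraMap ℚ 𝕜 q) x z }
  have hy' : IsNilpotent (LieDerivation.ad 𝕜 L y).toLinearMap := by
    rwa [LieDerivation.coe_ad_apply_eq_ad_apply]
  refine ⟨LieDerivation.exp _ hy', fun v hv ↦ ?_⟩
  have h3 : (LieDerivation.ad 𝕜 L y).toLinearMap ^ 3 • v = 0 := by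
    simpa [pow_succ] using hv
  have hq (q : ℚ) (w : L) : q • w = (algebraMap ℚ 𝕜 q) • w := rfl
  rw [LieDerivation.exp_map_apply]
  have := IsNilpotent.exp_smul_eq_sum h3 hy'
  rw [Module.End.smul_def] at this
  rw [this]
  simp [Finset.sum_range_succ, hq, pow_succ]

section

variable {𝕜 L : Type*} [Field 𝕜] [CharZero 𝕜] [LieRing L] [LieAlgebra 𝕜 L] [FiniteDimensional 𝕜 L]

lemma isNilpotent_ad_of_lie_eq_smul {h e : L} {c : 𝕜} (hc : c ≠ 0) (he : ⁅h, e⁆ = c • e) :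
    IsNilpotent (ad 𝕜 L e) := by
  refine isNilpotent_of_commutator_eq_smul (a := ad 𝕜 L h) hc ?_
  ext v
  simp [← lie_lie, he]

/-- The automorphism `exp(ad e) exp(-ad f) exp(ad e)` attached to an `sl₂`-triple `(e, h, f)`
negates `h` and fixes the centralizer of the triple. -/
lemma exists_lieEquiv_neg_of_sl2 {e h f : L} (hhe : ⁅h, e⁆ = (2 : 𝕜) • e)
    (hhf : ⁅h, f⁆ = (-2 : 𝕜) • f) (hef : ⁅e, f⁆ = h) :
    ∃ σ : L ≃ₗ⁅𝕜⁆ L, σ h = -h ∧ ∀ x, ⁅e, x⁆ = 0 → ⁅f, x⁆ = 0 → σ x = x := by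
  have he : IsNilpotent (ad 𝕜 L e) := isNilpotent_ad_of_lie_eq_smul two_ne_zero hhe
  have hf : IsNilpotent (ad 𝕜 L (-f)) := by
    rw [map_neg]
    exact (isNilpotent_ad_of_lie_eq_smul (neg_ne_zero.mpr two_ne_zero) hhf).neg
  have heh : ⁅e, h⁆ = (-2 : 𝕜) • e := by rw [← lie_skew, hhe, neg_smul]
  have hfh : ⁅f, h⁆ = (2 : 𝕜) • f := by rw [← lie_skew, hhf, neg_smul, neg_neg]
  have hfe : ⁅f, e⁆ = -h := by rw [← lie_skew, hef]
  obtain ⟨σ, hσ⟩ := exists_lieEquiv_exp_ad he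
  obtain ⟨τ, hτ⟩ := exists_lieEquiv_exp_ad hf
  have hσh : σ h = h - (2 : 𝕜) • e := by
    rw [hσ] <;> simp [heh, sub_eq_add_neg]
  have hσe : σ e = e := by
    rw [hσ] <;> simp
  have hτh : τ h = h - (2 : 𝕜) • f := by
    rw [hτ] <;> simp [hfh, sub_eq_add_neg]
  have hτe : τ e = e + h - f := by
    rw [hτ] <;> simp [hfh, hfe, sub_eq_add_neg]
  refine ⟨(σ.trans τ).trans σ, ?_, fun x hex hfx ↦ ?_⟩
  · have h1 : τ (σ h) = -h - (2 : 𝕜) • e := by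
      rw [hσh, map_sub, map_smul, hτh, hτe]
      module
    change σ (τ (σ h)) = -h
    rw [h1, map_sub, map_neg, map_smul, hσh, hσe]
    module
  · have h1 : σ x = x := by rw [hσ] <;> simp [hex]
    have h2 : τ x = x := by rw [hτ] <;> simp [hfx]
    simp [LieEquiv.trans_apply, h1, h2]

/-- The eigenvalues of the semisimple member of an `sl₂`-triple are integers. -/
lemma exists_int_of_sl2 {e h f : L} (hhe : ⁅h, e⁆ = (2 : 𝕜) • e)
    (hhf : ⁅h, f⁆ = (-2 : 𝕜) • f) (hef : ⁅e, f⁆ = h) {v : L} {κ : 𝕜} (hv : v ≠ 0)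
    (hκ : ⁅h, v⁆ = κ • v) : ∃ m : ℤ, κ = m := by
  obtain rfl | h0 := eq_or_ne h 0
  · refine ⟨0, ?_⟩
    simpa [hv, eq_comm] using hκ
  have t : IsSl2Triple h e f :=
    ⟨h0, hef, by rw [hhe, ofNat_smul_eq_nsmul], by rw [hhf, neg_smul, ofNat_smul_eq_nsmul]⟩
  obtain ⟨N, hN⟩ := isNilpotent_ad_of_lie_eq_smul two_ne_zero hhe
  obtain ⟨n, hn, hn'⟩ := Nat.exists_not_and_succ_of_not_zero_of_exists
    (p := fun n ↦ (toEnd 𝕜 L L e ^ n) v = 0) hv ⟨N, by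
      change (ad 𝕜 L e ^ N) v = 0
      simp [hN]⟩
  have P : t.HasPrimitiveVectorWith ((toEnd 𝕜 L L e ^ n) v) (κ + 2 * n) :=
    { ne_zero := hn
      lie_h := t.lie_h_pow_toEnd_e hκ n
      lie_e := by rwa [IsSl2Triple.lie_e_pow_toEnd_e (R := 𝕜) n] }
  obtain ⟨k, hk⟩ := P.exists_nat
  exact ⟨k - 2 * n, by push_cast; linear_combination hk⟩

end

/-- A sum over a set of roots as a weighted sum over all weights. -/
lemma finsum_isNonZero_eq_sum {𝕜 L : Type*} [Field 𝕜] [LieRing L] [LieAlgebra 𝕜 L]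
    [FiniteDimensional 𝕜 L] {H : LieSubalgebra 𝕜 L} [LieRing.IsNilpotent H] (x θ h : H)
    (p q : 𝕜 → Prop) [DecidablePred p] [DecidablePred q] :
    ∑ᶠ α ∈ {α : Weight 𝕜 H L | α.IsNonZero ∧ p (α θ) ∧ q (α h)}, α x =
      ∑ α : Weight 𝕜 H L, α x * (if p (α θ) then 1 else 0) * (if q (α h) then 1 else 0) := by
  rw [finsum_mem_def, finsum_eq_sum_of_fintype]
  refine Finset.sum_congr rfl fun α _ ↦ ?_
  by_cases hα : α.IsZero
  · simp [Set.indicator, show α x = 0 from congrFun hα x]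
  · by_cases hp : p (α θ) <;> by_cases hq : q (α h) <;> simp [Set.indicator, hα, hp, hq]

section Killing

variable {𝕜 L : Type*} [Field 𝕜] [CharZero 𝕜] [LieRing L] [LieAlgebra 𝕜 L] [FiniteDimensional 𝕜 L]
  [IsKilling 𝕜 L] {H : LieSubalgebra 𝕜 L} [H.IsCartanSubalgebra] [IsTriangularizable 𝕜 H L]

/-- The trace of an endomorphism acting as a scalar on each root space. -/
lemma trace_eq_sum_of_rootSpace_smul (T : Module.End 𝕜 L) (c : Weight 𝕜 H L → 𝕜)
    (hT : ∀ α : Weight 𝕜 H L, ∀ v ∈ rootSpace H α, T v = c α • v)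
    (hc : ∀ α : Weight 𝕜 H L, α.IsZero → c α = 0) :
    LinearMap.trace 𝕜 L T = ∑ α : Weight 𝕜 H L, c α := by
  classical
  have hmaps (α : Weight 𝕜 H L) : Set.MapsTo T (rootSpace H α).toSubmodule
      (rootSpace H α).toSubmodule := fun v hv ↦ by
    rw [hT α v hv]
    exact Submodule.smul_mem _ _ hv
  have hds := DirectSum.isInternal_submodule_of_iSupIndep_of_iSup_eq_top
    (LieSubmodule.iSupIndep_toSubmodule.mpr <| iSupIndep_genWeightSpace' 𝕜 H L)
    (LieSubmodule.iSup_toSubmodule_eq_top.mpr <| iSup_genWeightSpace_eq_top' 𝕜 H L)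
  rw [LinearMap.trace_eq_sum_trace_restrict hds hmaps]
  refine Finset.sum_congr rfl fun α _ ↦ ?_
  have hres : T.restrict (hmaps α) = c α • LinearMap.id := by
    ext v
    exact hT α v v.2
  rw [hres, map_smul, LinearMap.trace_id, smul_eq_mul]
  by_cases hα : α.IsZero
  · simp [hc α hα]
  · have : Module.finrank 𝕜 (rootSpace H α).toSubmodule = 1 :=
      IsKilling.finrank_rootSpace_eq_one α hα
    simp [this]

/-- If a Lie algebra automorphism fixes `x, θ ∈ H` and negates `h ∈ H`, then weighted sums of
values of roots at `x` are invariant under changing the sign of the values at `h`. -/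
lemma sum_weight_neg_eq (σ : L ≃ₗ⁅𝕜⁆ L) (x θ h : H) (hx : σ x = x) (hθ : σ θ = θ)
    (hh : σ h = -h) (φ ψ : 𝕜 → 𝕜) :
    ∑ α : Weight 𝕜 H L, α x * φ (α θ) * ψ (-α h) =
      ∑ α : Weight 𝕜 H L, α x * φ (α θ) * ψ (α h) := by
  classical
  obtain ⟨P, hP⟩ : ∃ P : Polynomial 𝕜, ∀ α : Weight 𝕜 H L, P.eval (α θ) = φ (α θ) :=
    ⟨Lagrange.interpolate (Finset.univ.image fun α : Weight 𝕜 H L ↦ α θ) id φ, fun α ↦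
      Lagrange.eval_interpolate_at_node (v := id) φ Function.injective_id.injOn
        (Finset.mem_image_of_mem _ (Finset.mem_univ α))⟩
  obtain ⟨Q, hQ⟩ : ∃ Q : Polynomial 𝕜, ∀ α : Weight 𝕜 H L,
      Q.eval (α h) = ψ (α h) ∧ Q.eval (-α h) = ψ (-α h) := by
    let s := Finset.univ.image (fun α : Weight 𝕜 H L ↦ α h) ∪
      Finset.univ.image (fun α : Weight 𝕜 H L ↦ -α h)
    have hs (z : 𝕜) (hz : z ∈ s) : (Lagrange.interpolate s id ψ).eval z = ψ z :=
      Lagrange.eval_interpolate_at_node (v := id) ψ Function.injective_id.injOn hz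
    exact ⟨Lagrange.interpolate s id ψ, fun α ↦ ⟨hs _ (by simp [s]), hs _ (by simp [s])⟩⟩
  let T (y : L) : Module.End 𝕜 L :=
    ad 𝕜 L x * (Polynomial.aeval (ad 𝕜 L θ) P * Polynomial.aeval (ad 𝕜 L y) Q)
  have haeval (p : Polynomial 𝕜) {y v : L} {c : 𝕜} (hv : ⁅y, v⁆ = c • v) :
      Polynomial.aeval (ad 𝕜 L y) p v = p.eval c • v :=
    Module.End.aeval_apply_of_mem_apply_eq_smul hv
  have htrace (y : H) : LinearMap.trace 𝕜 L (T y) =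
      ∑ α : Weight 𝕜 H L, α x * P.eval (α θ) * Q.eval (α y) := by
    refine trace_eq_sum_of_rootSpace_smul _ _ (fun α v hv ↦ ?_) fun α hα ↦ ?_
    · have key (z : H) : ⁅(z : L), v⁆ = α z • v := IsKilling.lie_eq_smul_of_mem_rootSpace hv z
      simp only [T, Module.End.mul_apply, haeval _ (key _), map_smul, ad_apply, key, smul_smul]
      ring_nf
    · simp [show α x = 0 from congrFun hα x]
  have hconj : LinearMap.trace 𝕜 L (T (-h)) = LinearMap.trace 𝕜 L (T h) := by
    have hcj (y : L) : σ.toLinearEquiv.conjAlgEquiv 𝕜 (ad 𝕜 L y) = ad 𝕜 L (σ y) :=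
      conj_ad_apply σ y
    have : σ.toLinearEquiv.conj (T h) = T (-h) := by
      change σ.toLinearEquiv.conjAlgEquiv 𝕜 (T h) = T (-h)
      simp only [T, map_mul, ← Polynomial.aeval_algHom_apply, hcj, hx, hθ, hh]
    rw [← this, LinearMap.trace_conj']
  have hneg := htrace (-h)
  rw [NegMemClass.coe_neg, hconj, htrace h] at hneg
  have hα (α : Weight 𝕜 H L) : α (-h) = -α h := map_neg (Weight.toLinear 𝕜 H L α) h
  simpa only [hα, hP, hQ] using hneg.symm

/-- Under the assumptions of `sum_weight_neg_eq`, weighted sums of values of roots at `x` are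
negated by changing the sign of the values at `θ`. -/
lemma sum_weight_eq_neg (σ : L ≃ₗ⁅𝕜⁆ L) (x θ h : H) (hx : σ x = x) (hθ : σ θ = θ)
    (hh : σ h = -h) (φ ψ : 𝕜 → 𝕜) :
    ∑ α : Weight 𝕜 H L, α x * φ (α θ) * ψ (α h) =
      -∑ α : Weight 𝕜 H L, α x * φ (-α θ) * ψ (α h) := by
  rw [← sum_weight_neg_eq σ x θ h hx hθ hh (fun z ↦ φ (-z)) ψ, ← Finset.sum_neg_distrib,
    ← Equiv.sum_comp (Equiv.neg (Weight 𝕜 H L))]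
  simp

end Killing

end LieAlgebra

/-- Let `𝔤` be a finite-dimensional semisimple Lie algebra over an algebraically closed field of
characteristic `0`, `𝔥` a Cartan subalgebra with roots `Δ` (nonzero weights of the adjoint
representation), `𝔱 ⊆ 𝔥` a subspace, `(e, h, f)` an `sl₂`-triple centralizing `𝔱` with `h ∈ 𝔥`,
and `θ ∈ 𝔱` with `α(θ) ∈ ℤ` for all roots `α` and `α(θ) ≠ 0` whenever `α|_𝔱 ≠ 0`.  Define
`δ := (1/2)∑_{α(θ)<0, α(h)=-1} α + ∑_{α(θ)<0, α(h)≤-2} α`,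
`δ' := (1/2)∑_{α(θ)>0, α(h)∈{0,1}} α` and `ρ_θ := (1/2)∑_{α(θ)>0} α`.
Then `(δ' - δ - ρ_θ)|_𝔱 = 0`. -/
theorem delta_congruence
    (𝕜 : Type*) [Field 𝕜] [IsAlgClosed 𝕜] [CharZero 𝕜]
    (L : Type*) [LieRing L] [LieAlgebra 𝕜 L] [FiniteDimensional 𝕜 L]
    [LieAlgebra.IsSemisimple 𝕜 L]
    (H : LieSubalgebra 𝕜 L) [H.IsCartanSubalgebra]
    (t : Submodule 𝕜 L) (ht : ∀ x ∈ t, x ∈ H)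
    (e h f : L)
    (hhe : ⁅h, e⁆ = (2 : 𝕜) • e) (hhf : ⁅h, f⁆ = (-2 : 𝕜) • f) (hef : ⁅e, f⁆ = h)
    (hcent : ∀ x ∈ t, ⁅e, x⁆ = 0 ∧ ⁅h, x⁆ = 0 ∧ ⁅f, x⁆ = 0)
    (hh : h ∈ H)
    (θ : L) (hθt : θ ∈ t)
    -- `α(θ)` is an integer for every root `α`
    (hint : ∀ α : Weight 𝕜 H L, α.IsNonZero → ∃ m : ℤ, α ⟨θ, ht θ hθt⟩ = (m : 𝕜))
    -- `α(θ) ≠ 0` for every root `α` with `α|_𝔱 ≠ 0`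
    (hreg : ∀ α : Weight 𝕜 H L, α.IsNonZero →
      (¬ ∀ x (hx : x ∈ t), α ⟨x, ht x hx⟩ = 0) → α ⟨θ, ht θ hθt⟩ ≠ 0) :
    ∀ x (hx : x ∈ t),
      -- δ'(x)
      (∑ᶠ α ∈ {α : Weight 𝕜 H L | α.IsNonZero ∧
          (∃ m : ℤ, 0 < m ∧ α ⟨θ, ht θ hθt⟩ = (m : 𝕜)) ∧
          (α ⟨h, hh⟩ = 0 ∨ α ⟨h, hh⟩ = 1)}, α ⟨x, ht x hx⟩) / 2
      -- − δ(x)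
      - ((∑ᶠ α ∈ {α : Weight 𝕜 H L | α.IsNonZero ∧
            (∃ m : ℤ, m < 0 ∧ α ⟨θ, ht θ hθt⟩ = (m : 𝕜)) ∧
            α ⟨h, hh⟩ = -1}, α ⟨x, ht x hx⟩) / 2
        + ∑ᶠ α ∈ {α : Weight 𝕜 H L | α.IsNonZero ∧
            (∃ m : ℤ, m < 0 ∧ α ⟨θ, ht θ hθt⟩ = (m : 𝕜)) ∧
            (∃ m : ℤ, m ≤ -2 ∧ α ⟨h, hh⟩ = (m : 𝕜))}, α ⟨x, ht x hx⟩)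
      -- − ρ_θ(x)
      - (∑ᶠ α ∈ {α : Weight 𝕜 H L | α.IsNonZero ∧
          (∃ m : ℤ, 0 < m ∧ α ⟨θ, ht θ hθt⟩ = (m : 𝕜))}, α ⟨x, ht x hx⟩) / 2
      = 0 := by
  classical
  intro x hx
  obtain ⟨σ, hσh, hσ⟩ := LieAlgebra.exists_lieEquiv_neg_of_sl2 hhe hhf hef
  have hfix (y : L) (hy : y ∈ t) : σ y = y := hσ y (hcent y hy).1 (hcent y hy).2.2
  have hρ := LieAlgebra.finsum_isNonZero_eq_sum (𝕜 := 𝕜) ⟨x, ht x hx⟩ ⟨θ, ht θ hθt⟩ ⟨h, hh⟩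
    (fun z ↦ ∃ m : ℤ, 0 < m ∧ z = m) (fun _ ↦ True)
  simp only [and_true] at hρ
  have hflip (p : 𝕜 → Prop) := LieAlgebra.sum_weight_eq_neg σ ⟨x, ht x hx⟩ ⟨θ, ht θ hθt⟩ ⟨h, hh⟩
    (hfix x hx) (hfix θ hθt) hσh (fun z ↦ if ∃ m : ℤ, m < 0 ∧ z = m then 1 else 0)
    (fun z ↦ if p z then 1 else 0)
  have hsymm := LieAlgebra.sum_weight_neg_eq σ ⟨x, ht x hx⟩ ⟨θ, ht θ hθt⟩ ⟨h, hh⟩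
    (hfix x hx) (hfix θ hθt) hσh (fun z ↦ if ∃ m : ℤ, m < 0 ∧ -z = m then 1 else 0)
    (fun z ↦ if ∃ m : ℤ, m ≤ -2 ∧ z = m then 1 else 0)
  have hneg (z : 𝕜) : (∃ m : ℤ, m < 0 ∧ -z = m) ↔ ∃ m : ℤ, 0 < m ∧ z = m :=
    ⟨fun ⟨m, hm, hz⟩ ↦ ⟨-m, by lia, by push_cast; rw [← hz, neg_neg]⟩,
      fun ⟨m, hm, hz⟩ ↦ ⟨-m, by lia, by push_cast; rw [hz]⟩⟩
  rw [hρ,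
    LieAlgebra.finsum_isNonZero_eq_sum ⟨x, ht x hx⟩ ⟨θ, ht θ hθt⟩ ⟨h, hh⟩
      (fun z ↦ ∃ m : ℤ, 0 < m ∧ z = m) (fun z ↦ z = 0 ∨ z = 1),
    LieAlgebra.finsum_isNonZero_eq_sum ⟨x, ht x hx⟩ ⟨θ, ht θ hθt⟩ ⟨h, hh⟩
      (fun z ↦ ∃ m : ℤ, m < 0 ∧ z = m) (fun z ↦ z = -1),
    LieAlgebra.finsum_isNonZero_eq_sum ⟨x, ht x hx⟩ ⟨θ, ht θ hθt⟩ ⟨h, hh⟩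
      (fun z ↦ ∃ m : ℤ, m < 0 ∧ z = m) (fun z ↦ ∃ m : ℤ, m ≤ -2 ∧ z = m),
    hflip (fun z ↦ z = -1), hflip (fun z ↦ ∃ m : ℤ, m ≤ -2 ∧ z = m)]
  simp only [hneg] at hsymm ⊢
  refine mul_left_cancel₀ (two_ne_zero (α := 𝕜)) ?_
  rw [mul_zero]
  trans ∑ α : Weight 𝕜 H L, α ⟨x, ht x hx⟩ *
      (if ∃ m : ℤ, 0 < m ∧ α ⟨θ, ht θ hθt⟩ = m then 1 else 0) *
      ((if α ⟨h, hh⟩ = 0 ∨ α ⟨h, hh⟩ = 1 then 1 else 0) + (if α ⟨h, hh⟩ = -1 then 1 else 0) +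
        (if ∃ m : ℤ, m ≤ -2 ∧ α ⟨h, hh⟩ = m then 1 else 0) +
        (if ∃ m : ℤ, m ≤ -2 ∧ -α ⟨h, hh⟩ = m then 1 else 0) - (if True then 1 else 0))
  · simp only [mul_add, mul_sub, Finset.sum_add_distrib, Finset.sum_sub_distrib] at hsymm ⊢
    linear_combination -hsymm
  · refine Finset.sum_eq_zero fun α _ ↦ mul_eq_zero_of_right _ ?_
    obtain ⟨v, hv, hv0⟩ := α.exists_ne_zero
    obtain ⟨k, hk⟩ := LieAlgebra.exists_int_of_sl2 hhe hhf hef hv0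
      (LieAlgebra.IsKilling.lie_eq_smul_of_mem_rootSpace hv ⟨h, hh⟩)
    rw [hk]
    norm_cast
    simp only [exists_eq_right']
    split_ifs <;> lia
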